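/- arXiv:1204.0972 — 8 statements merged into one kernel-verified Lean document; each statement's English description precedes it below -/
import Mathlib

section
/- Let -1 < q < 1 and let x, t ∈ ℝ with |x| ≤ 1 and |t| < 1. Assume that for every m ≥ 0 the series ∑_{i≥0} (t^i/(q)_i)·h_{m+i}(x|q) converges absolutely. Then for every n ≥ 0: ∑_{i≥0} (t^i/(q)_i)·h_{n+i}(x|q) = h_n(x|t,q) · ∑_{i≥0} (t^i/(q)_i)·h_i(x|q). -/
open scoped BigOperators

/-- The q-Pochhammer symbol `(a;q)_n = ∏_{j=0}^{n-1} (1 - a q^j)`. -/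
noncomputable def qPoch (a q : ℝ) (n : ℕ) : ℝ := ∏ j ∈ Finset.range n, (1 - a * q ^ j)

/-- Evaluation of the ℤ-indexed Chebyshev polynomial of the second kind. -/
noncomputable def chebU (x : ℝ) (n : ℤ) : ℝ := (Polynomial.Chebyshev.U ℝ n).eval x

/-- The continuous q-Hermite polynomials `h_n(x|q)`. -/
noncomputable def qHermite (q x : ℝ) : ℕ → ℝ
  | 0 => 1
  | 1 => 2 * x
  | n + 2 => 2 * x * qHermite q x (n + 1) - (1 - q ^ (n + 1)) * qHermite q x n

/-- The big q-Hermite polynomials `h_n(x|a,q)`. -/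
noncomputable def bigQHermite (a q x : ℝ) : ℕ → ℝ
  | 0 => 1
  | 1 => 2 * x - a
  | n + 2 => (2 * x - a * q ^ (n + 1)) * bigQHermite a q x (n + 1)
      - (1 - q ^ (n + 1)) * bigQHermite a q x n

/-- The Al-Salam–Chihara polynomials `Q_n(x|a,b,q)`. -/
noncomputable def alSalamChihara (a b q x : ℝ) : ℕ → ℝ
  | 0 => 1
  | 1 => 2 * x - (a + b)
  | n + 2 => (2 * x - (a + b) * q ^ (n + 1)) * alSalamChihara a b q x (n + 1)
      - (1 - a * b * q ^ n) * (1 - q ^ (n + 1)) * alSalamChihara a b q x n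

/-- The continuous dual q-Hahn polynomials `ψ_n(x|a,b,c,q)`. -/
noncomputable def cdqHahn (a b c q x : ℝ) : ℕ → ℝ
  | 0 => 1
  | 1 => 2 * x - (a + b + c) + a * b * c
  | n + 2 =>
      (2 * x - ((a + b + c) * q ^ (n + 1)
          + a * b * c * q ^ n * (1 - q ^ (n + 1) - q ^ (n + 2))))
        * cdqHahn a b c q x (n + 1)
      - (1 - a * b * q ^ n) * (1 - a * c * q ^ n) * (1 - b * c * q ^ n)
          * (1 - q ^ (n + 1)) * cdqHahn a b c q x n

theorem qPoch_self_succ (q : ℝ) (n : ℕ) :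
    qPoch q q (n + 1) = qPoch q q n * (1 - q ^ (n + 1)) := by
  rw [qPoch, Finset.prod_range_succ, ← pow_succ', qPoch]

/-- Multiplying the coefficients `t ^ i / (q;q)_i` by `1 - q ^ i` shifts the series by one index. -/
theorem hasSum_div_qPoch_mul_one_sub_pow {q t s : ℝ} (hq : -1 < q) (hq1 : q < 1) {f g : ℕ → ℝ}
    (hfg : ∀ i, f (i + 1) = g i) (hg : HasSum (fun i => t ^ i / qPoch q q i * g i) s) :
    HasSum (fun i => t ^ i / qPoch q q i * ((1 - q ^ i) * f i)) (t * s) := by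
  rw [← hasSum_nat_add_iff' 1, Finset.sum_range_one, pow_zero, pow_zero, sub_self, zero_mul,
    mul_zero, sub_zero]
  convert! hg.mul_left t using 1
  funext i
  have h : 1 - q ^ (i + 1) ≠ 0 := by
    have := pow_lt_one₀ (abs_nonneg q) (abs_lt.mpr ⟨hq, hq1⟩) i.succ_ne_zero
    rw [← abs_pow] at this
    exact (sub_pos.mpr (abs_lt.mp this).2).ne'
  rw [hfg, qPoch_self_succ, ← mul_assoc, div_mul_eq_mul_div, mul_div_mul_right _ _ h]
  ring

theorem qHermite_shifted_generating_function (q x t : ℝ) (hq : -1 < q) (hq1 : q < 1)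
    (hx : |x| ≤ 1) (ht : |t| < 1)
    (hsum : ∀ m : ℕ, Summable fun i : ℕ => |t ^ i / qPoch q q i * qHermite q x (m + i)|) :
    ∀ n : ℕ,
      (∑' i : ℕ, t ^ i / qPoch q q i * qHermite q x (n + i)) =
        bigQHermite t q x n * ∑' i : ℕ, t ^ i / qPoch q q i * qHermite q x i := by
  have hS (m : ℕ) := (hsum m).of_abs.hasSum
  intro n
  induction n using Nat.twoStepInduction with
  | zero => simp [bigQHermite]
  | one =>
    have h0 := hS 0
    simp only [zero_add] at h0
    have hshift := hasSum_div_qPoch_mul_one_sub_pow (f := fun i => qHermite q x (i - 1)) hq hq1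
      (fun i => rfl) h0
    have hrec := (h0.mul_left (2 * x)).sub hshift
    rw [bigQHermite, sub_mul, ← hrec.tsum_eq]
    refine tsum_congr fun i => ?_
    rcases i with _ | i
    · simp [qHermite, mul_comm]
    · rw [add_comm 1, qHermite, Nat.add_sub_cancel]
      ring
  | more n ih0 ih1 =>
    have hshift := hasSum_div_qPoch_mul_one_sub_pow (f := fun i => qHermite q x (n + i)) hq hq1
      (fun i => by rw [add_right_comm, add_assoc]) (hS (n + 1))
    have hrec := (((hS (n + 1)).mul_left (2 * x)).sub ((hS n).mul_left (1 - q ^ (n + 1)))).sub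
      (hshift.mul_left (q ^ (n + 1)))
    have hval := hrec.tsum_eq
    rw [ih0, ih1] at hval
    rw [bigQHermite]
    refine (tsum_congr fun i => ?_).trans (hval.trans (by ring))
    rw [add_right_comm n 2 i, add_right_comm n 1 i, qHermite]
    ring
end

section
/- Let -1 < q < 1 and let a, x, t ∈ ℝ with |x| ≤ 1, |t| < 1 and |at| < 1. Assume that for every m ≥ 0 the series ∑_{i≥0} (t^i/(q)_i)·h_{m+i}(x|a,q) converges absolutely. Then for every n ≥ 0: (at;q)_n · ∑_{i≥0} (t^i/(q)_i)·h_{n+i}(x|a,q) = Q_n(x|a,t,q) · ∑_{i≥0} (t^i/(q)_i)·h_i(x|a,q), where Q_n(x|a,t,q) is the Al-Salam–Chihara polynomial with parameters a and t. -/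
open scoped BigOperators

theorem qPoch_succ (a q : ℝ) (n : ℕ) : qPoch a q (n + 1) = qPoch a q n * (1 - a * q ^ n) :=
  Finset.prod_range_succ _ _

theorem qPoch_self_ne_zero {q : ℝ} (hq : -1 < q) (hq1 : q < 1) (n : ℕ) : qPoch q q n ≠ 0 := by
  refine Finset.prod_ne_zero_iff.2 fun j _ h => ?_
  have h1 : |q| ^ (j + 1) < 1 := pow_lt_one₀ (abs_nonneg q) (abs_lt.2 ⟨hq, hq1⟩) j.succ_ne_zero
  rw [← abs_pow, pow_succ'] at h1
  linarith [le_abs_self (q * q ^ j)]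

/-- The three-term recurrence in a uniform shape: for `m = 0` the last coefficient vanishes. -/
theorem bigQHermite_succ (a q x : ℝ) (m : ℕ) :
    bigQHermite a q x (m + 1) = (2 * x - a * q ^ m) * bigQHermite a q x m
      - (1 - q ^ m) * bigQHermite a q x (m - 1) := by
  cases m <;> simp [bigQHermite]

/-- The three-term recurrence in a uniform shape: for `m = 0` the last coefficient vanishes. -/
theorem alSalamChihara_succ (a b q x : ℝ) (m : ℕ) :
    alSalamChihara a b q x (m + 1) = (2 * x - (a + b) * q ^ m) * alSalamChihara a b q x m
      - (1 - a * b * q ^ (m - 1)) * (1 - q ^ m) * alSalamChihara a b q x (m - 1) := by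
  cases m <;> simp [alSalamChihara]

theorem hasSum_one_sub_pow_mul {q t : ℝ} (hq : -1 < q) (hq1 : q < 1) {f : ℕ → ℝ} {s : ℝ}
    (hf : HasSum (fun i : ℕ => t ^ i / qPoch q q i * f (i + 1)) s) :
    HasSum (fun i : ℕ => (1 - q ^ i) * (t ^ i / qPoch q q i * f i)) (t * s) := by
  rw [← hasSum_nat_add_iff' 1]
  simp only [Finset.range_one, Finset.sum_singleton, pow_zero, sub_self, zero_mul, sub_zero]
  refine (hf.mul_left t).congr_fun fun i => ?_
  have h := qPoch_self_ne_zero hq hq1 (i + 1)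
  rw [qPoch_succ] at h ⊢
  have h1 := left_ne_zero_of_mul h
  have h2 := right_ne_zero_of_mul h
  rw [pow_succ' q, pow_succ t]
  field_simp

theorem bigQHermite_shifted_sum_succ {q a x t : ℝ} (hq : -1 < q) (hq1 : q < 1) {S : ℕ → ℝ}
    (hS : ∀ m, HasSum (fun i : ℕ => t ^ i / qPoch q q i * bigQHermite a q x (m + i)) (S m))
    (n : ℕ) :
    (1 - a * t * q ^ n) * S (n + 1) =
      (2 * x - (a + t) * q ^ n) * S n - (1 - q ^ n) * S (n - 1) := by
  have h1 := hasSum_one_sub_pow_mul hq hq1 (f := fun i => bigQHermite a q x (n + i))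
    (by simpa only [add_right_comm, add_assoc] using hS (n + 1))
  have h2 := hasSum_one_sub_pow_mul hq hq1 (f := fun i => bigQHermite a q x (n + i - 1)) (hS n)
  have h := ((((hS n).mul_left (2 * x - a * q ^ n)).add (h1.mul_left (a * q ^ n))).sub
    ((hS (n - 1)).mul_left (1 - q ^ n))).sub (h2.mul_left (q ^ n))
  have key : S (n + 1) = _ := (hS (n + 1)).unique (h.congr_fun fun i => ?_)
  · linear_combination key
  have hsplit : (1 - q ^ n) * bigQHermite a q x (n - 1 + i) =
      (1 - q ^ n) * bigQHermite a q x (n + i - 1) := by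
    cases n with
    | zero => simp
    | succ k => rw [Nat.add_sub_cancel, Nat.add_right_comm, Nat.add_sub_cancel]
  rw [Nat.add_right_comm, bigQHermite_succ, pow_add]
  linear_combination (t ^ i / qPoch q q i) * hsplit

theorem bigQHermite_shifted_generating_function (q a x t : ℝ) (hq : -1 < q) (hq1 : q < 1)
    (hx : |x| ≤ 1) (ht : |t| < 1) (hat : |a * t| < 1)
    (hsum : ∀ m : ℕ, Summable fun i : ℕ => |t ^ i / qPoch q q i * bigQHermite a q x (m + i)|) :
    ∀ n : ℕ,
      qPoch (a * t) q n * ∑' i : ℕ, t ^ i / qPoch q q i * bigQHermite a q x (n + i) =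
        alSalamChihara a t q x n * ∑' i : ℕ, t ^ i / qPoch q q i * bigQHermite a q x i := by
  have hS : ∀ m, HasSum (fun i : ℕ => t ^ i / qPoch q q i * bigQHermite a q x (m + i))
      (∑' i : ℕ, t ^ i / qPoch q q i * bigQHermite a q x (m + i)) :=
    fun m => (hsum m).of_abs.hasSum
  have hrec := bigQHermite_shifted_sum_succ hq hq1 hS
  intro n
  induction n using Nat.strong_induction_on with
  | _ n ih =>
    match n with
    | 0 => simp [qPoch, alSalamChihara]
    | 1 =>
      have h := hrec 0
      simp only [pow_zero, sub_self, zero_mul, sub_zero, zero_add, mul_one] at h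
      simpa [qPoch, alSalamChihara] using h
    | m + 2 =>
      have h0 := ih m (by omega)
      have h1 := ih (m + 1) (by omega)
      have h := hrec (m + 1)
      rw [Nat.add_sub_cancel] at h
      rw [alSalamChihara_succ, Nat.add_sub_cancel, qPoch_succ _ _ (m + 1)]
      have h2 := qPoch_succ (a * t) q m
      linear_combination qPoch (a * t) q (m + 1) * h
        + (2 * x - (a + t) * q ^ (m + 1)) * h1
        - (1 - a * t * q ^ m) * (1 - q ^ (m + 1)) * h0
        - (1 - q ^ (m + 1)) * (∑' i : ℕ, t ^ i / qPoch q q i * bigQHermite a q x (m + i)) * h2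
end

section
/- Let -1 < q < 1 and let a, b, x, t ∈ ℝ with |x| ≤ 1, |t| < 1, |at| < 1 and |bt| < 1. Assume that for every m ≥ 0 the series ∑_{i≥0} (t^i/(q)_i)·Q_{m+i}(x|a,b,q) converges absolutely. Then for every n ≥ 0: (at;q)_n (bt;q)_n · ∑_{i≥0} (t^i/(q)_i)·Q_{n+i}(x|a,b,q) = ψ_n(x|a,b,t,q) · ∑_{i≥0} (t^i/(q)_i)·Q_i(x|a,b,q), where ψ_n(x|a,b,t,q) is the continuous dual q-Hahn polynomial with parameters a, b and t. -/
open scoped BigOperators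

theorem HasSum.congr_pointwise {f g : ℕ → ℝ} {s : ℝ} (h : HasSum f s) (hfg : ∀ i, g i = f i) :
    HasSum g s := by
  rwa [funext hfg]

theorem one_sub_pow_succ_ne_zero {q : ℝ} (hq : -1 < q) (hq1 : q < 1) (n : ℕ) :
    1 - q ^ (n + 1) ≠ 0 := by
  have h : |q ^ (n + 1)| < 1 := by
    rw [abs_pow]
    exact pow_lt_one₀ (abs_nonneg q) (abs_lt.2 ⟨hq, hq1⟩) n.succ_ne_zero
  linarith [(abs_lt.1 h).2]

theorem qExpWeight_succ {q : ℝ} (hq : -1 < q) (hq1 : q < 1) (t : ℝ) (i : ℕ) :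
    t ^ (i + 1) / qPoch q q (i + 1) * (1 - q ^ (i + 1)) = t * (t ^ i / qPoch q q i) := by
  have h := one_sub_pow_succ_ne_zero hq hq1 i
  rw [qPoch_succ, ← pow_succ' q i, div_mul_eq_mul_div, mul_div_mul_right _ _ h, pow_succ]
  ring

/-- Summation by shift against the weights `t ^ i / (q;q)_i`. -/
theorem hasSum_qExpWeight_mul_one_sub_pow {q : ℝ} (hq : -1 < q) (hq1 : q < 1) {t s : ℝ}
    {u : ℕ → ℝ} (h : HasSum (fun i => t ^ i / qPoch q q i * u (i + 1)) s) :
    HasSum (fun i => t ^ i / qPoch q q i * (1 - q ^ i) * u i) (t * s) := by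
  rw [← hasSum_nat_add_iff' 1]
  simp only [Finset.range_one, Finset.sum_singleton, pow_zero, sub_self, mul_zero, zero_mul,
    sub_zero]
  refine (h.mul_left t).congr_pointwise fun i => ?_
  rw [qExpWeight_succ hq hq1, mul_assoc]

/-- The effect of replacing `t` by `q * t` in `∑ t ^ i / (q;q)_i * u i`. -/
theorem hasSum_qExpWeight_mul_pow {q : ℝ} (hq : -1 < q) (hq1 : q < 1) {t r s : ℝ}
    {u : ℕ → ℝ} (h₀ : HasSum (fun i => t ^ i / qPoch q q i * u i) r)
    (h₁ : HasSum (fun i => t ^ i / qPoch q q i * u (i + 1)) s) :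
    HasSum (fun i => t ^ i / qPoch q q i * (q ^ i * u i)) (r - t * s) := by
  refine (h₀.sub (hasSum_qExpWeight_mul_one_sub_pow hq hq1 h₁)).congr_pointwise fun i => ?_
  ring

theorem alSalamChihara_shifted_sum_one {q a b x t : ℝ} (hq : -1 < q) (hq1 : q < 1) {F : ℕ → ℝ}
    (hF : ∀ n, HasSum (fun i => t ^ i / qPoch q q i * alSalamChihara a b q x (n + i)) (F n)) :
    (1 - a * t) * (1 - b * t) * F 1 = (2 * x - (a + b + t) + a * b * t) * F 0 := by
  have h0 : HasSum (fun i => t ^ i / qPoch q q i * alSalamChihara a b q x i) (F 0) := by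
    simpa only [zero_add] using hF 0
  have h1 : HasSum (fun i => t ^ i / qPoch q q i * alSalamChihara a b q x (i + 1)) (F 1) := by
    simpa only [add_comm 1] using hF 1
  have hp := hasSum_qExpWeight_mul_pow hq hq1 h0 h1
  have hs : HasSum (fun i => t ^ i / qPoch q q i * (1 - q ^ i) *
      ((1 - a * b * q ^ (i - 1)) * alSalamChihara a b q x (i - 1)))
      (t * (F 0 - a * b * (F 0 - t * F 1))) := by
    refine hasSum_qExpWeight_mul_one_sub_pow hq hq1
      ((h0.sub (hp.mul_left (a * b))).congr_pointwise fun i => ?_)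
    rw [Nat.add_sub_cancel]
    ring
  have hr := ((h0.mul_left (2 * x)).sub (hp.mul_left (a + b))).sub hs
  have he := h1.unique (hr.congr_pointwise fun i => by
    cases i with
    | zero => simp [alSalamChihara, qPoch]
    | succ i =>
      rw [alSalamChihara, Nat.add_sub_cancel]
      ring)
  linear_combination he

theorem alSalamChihara_shifted_sum_add_two {q a b x t : ℝ} (hq : -1 < q) (hq1 : q < 1)
    {F : ℕ → ℝ}
    (hF : ∀ n, HasSum (fun i => t ^ i / qPoch q q i * alSalamChihara a b q x (n + i)) (F n))
    (n : ℕ) :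
    (1 - a * t * q ^ (n + 1)) * (1 - b * t * q ^ (n + 1)) * F (n + 2) =
      (2 * x - ((a + b + t) * q ^ (n + 1)
          + a * b * t * q ^ n * (1 - q ^ (n + 1) - q ^ (n + 2)))) * F (n + 1)
        - (1 - a * b * q ^ n) * (1 - q ^ (n + 1)) * F n := by
  have hp (m : ℕ) : HasSum (fun i => t ^ i / qPoch q q i *
      (q ^ i * alSalamChihara a b q x (m + i))) (F m - t * F (m + 1)) :=
    hasSum_qExpWeight_mul_pow hq hq1 (hF m) (by
      simpa only [add_assoc, add_comm 1] using hF (m + 1))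
  have hpp : HasSum (fun i => t ^ i / qPoch q q i *
      (q ^ i * (q ^ i * alSalamChihara a b q x (n + i))))
      (F n - t * F (n + 1) - t * (q * (F (n + 1) - t * F (n + 2)))) := by
    refine hasSum_qExpWeight_mul_pow hq hq1 (hp n)
      (((hp (n + 1)).mul_left q).congr_pointwise fun i => ?_)
    rw [add_right_comm n 1 i, ← add_assoc]
    ring
  have hr := ((((hF (n + 1)).mul_left (2 * x)).sub
    ((hp (n + 1)).mul_left ((a + b) * q ^ (n + 1)))).sub (hF n)).add
    (((hp n).mul_left (a * b * q ^ n + q ^ (n + 1))).sub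
      (hpp.mul_left (a * b * q ^ n * q ^ (n + 1))))
  have he := (hF (n + 2)).unique (hr.congr_pointwise fun i => by
    rw [add_right_comm n 2 i, add_right_comm n 1 i, alSalamChihara]
    ring)
  linear_combination he

theorem alSalamChihara_shifted_generating_function (q a b x t : ℝ) (hq : -1 < q) (hq1 : q < 1)
    (hx : |x| ≤ 1) (ht : |t| < 1) (hat : |a * t| < 1) (hbt : |b * t| < 1)
    (hsum : ∀ m : ℕ, Summable fun i : ℕ => |t ^ i / qPoch q q i * alSalamChihara a b q x (m + i)|) :
    ∀ n : ℕ,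
      qPoch (a * t) q n * qPoch (b * t) q n *
          ∑' i : ℕ, t ^ i / qPoch q q i * alSalamChihara a b q x (n + i) =
        cdqHahn a b t q x n * ∑' i : ℕ, t ^ i / qPoch q q i * alSalamChihara a b q x i := by
  set F : ℕ → ℝ := fun n =>
    ∑' i : ℕ, t ^ i / qPoch q q i * alSalamChihara a b q x (n + i) with hFdef
  have hF (n : ℕ) :
      HasSum (fun i => t ^ i / qPoch q q i * alSalamChihara a b q x (n + i)) (F n) :=
    (hsum n).of_abs.hasSum
  have h0 : ∑' i : ℕ, t ^ i / qPoch q q i * alSalamChihara a b q x i = F 0 := by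
    simp only [hFdef, zero_add]
  rw [h0]
  intro n
  change qPoch (a * t) q n * qPoch (b * t) q n * F n = cdqHahn a b t q x n * F 0
  induction n using Nat.twoStepInduction with
  | zero => simp [qPoch, cdqHahn]
  | one =>
    simp only [qPoch, cdqHahn, Finset.prod_range_one, pow_zero, mul_one]
    exact alSalamChihara_shifted_sum_one hq hq1 hF
  | more n ih₀ ih₁ =>
    have hr := alSalamChihara_shifted_sum_add_two hq hq1 hF n
    rw [qPoch_succ _ _ n, qPoch_succ _ _ n] at ih₁
    rw [cdqHahn, qPoch_succ _ _ (n + 1), qPoch_succ _ _ (n + 1), qPoch_succ _ _ n,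
      qPoch_succ _ _ n]
    linear_combination
      qPoch (a * t) q n * (1 - a * t * q ^ n) * (qPoch (b * t) q n * (1 - b * t * q ^ n)) * hr
      + (2 * x - ((a + b + t) * q ^ (n + 1)
          + a * b * t * q ^ n * (1 - q ^ (n + 1) - q ^ (n + 2)))) * ih₁
      - (1 - a * b * q ^ n) * (1 - a * t * q ^ n) * (1 - b * t * q ^ n)
          * (1 - q ^ (n + 1)) * ih₀
end

section
/- Let x, t ∈ ℝ and assume that for every m ≥ 0 the series ∑_{j≥0} (t^j/j!)·H_{m+j}(x) converges absolutely. Then for every n ≥ 0: ∑_{j≥0} (t^j/j!)·H_{n+j}(x) = H_n(x - t) · ∑_{j≥0} (t^j/j!)·H_j(x). -/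
/-- The physicists' Hermite polynomials `H_n(x)`. -/
noncomputable def hermiteH (x : ℝ) : ℕ → ℝ
  | 0 => 1
  | 1 => 2 * x
  | n + 2 => 2 * x * hermiteH x (n + 1) - 2 * (n + 1) * hermiteH x n

theorem hasSum_pow_div_factorial_mul_nat_mul {t s : ℝ} {g : ℕ → ℝ}
    (h : HasSum (fun j : ℕ => t ^ j / (Nat.factorial j) * g (j + 1)) s) :
    HasSum (fun j : ℕ => t ^ j / (Nat.factorial j) * (j * g j)) (t * s) := by
  rw [← hasSum_nat_add_iff' 1]
  simp only [Finset.sum_range_one, Nat.cast_zero, zero_mul, mul_zero, sub_zero]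
  refine (h.mul_left t).congr_fun fun j => ?_
  rw [Nat.factorial_succ]
  push_cast
  field_simp
  ring

theorem hermiteH_succ (x : ℝ) (j : ℕ) :
    hermiteH x (j + 1) = 2 * x * hermiteH x j - 2 * (j * hermiteH x (j - 1)) := by
  cases j with
  | zero => simp [hermiteH]
  | succ j =>
    rw [hermiteH, Nat.add_sub_cancel]
    push_cast
    ring

theorem hermite_shifted_generating_function (x t : ℝ)
    (hsum : ∀ m : ℕ, Summable fun j : ℕ => |t ^ j / (Nat.factorial j) * hermiteH x (m + j)|) :
    ∀ n : ℕ,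
      (∑' j : ℕ, t ^ j / (Nat.factorial j) * hermiteH x (n + j)) =
        hermiteH (x - t) n * ∑' j : ℕ, t ^ j / (Nat.factorial j) * hermiteH x j := by
  have hS (m : ℕ) := (hsum m).of_abs.hasSum
  intro n
  induction n using Nat.twoStepInduction with
  | zero => simp [hermiteH]
  | one =>
    have h0 := hS 0
    simp only [zero_add] at h0
    have h1 := hasSum_pow_div_factorial_mul_nat_mul (g := fun j => hermiteH x (j - 1)) h0
    have h2 := (h0.mul_left (2 * x)).sub (h1.mul_left 2)
    refine (tsum_congr fun j => ?_).trans (h2.tsum_eq.trans ?_)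
    · rw [add_comm 1 j, hermiteH_succ]
      ring
    · rw [hermiteH]
      ring
  | more n ih0 ih1 =>
    have h1 := hS (n + 1)
    have h2 := hasSum_pow_div_factorial_mul_nat_mul (t := t) (g := fun j => hermiteH x (n + j))
      (by simpa only [add_right_comm, add_assoc, add_comm 1] using h1)
    have h3 := ((h1.mul_left (2 * x)).sub (h2.mul_left 2)).sub ((hS n).mul_left (2 * ((n : ℝ) + 1)))
    refine (tsum_congr fun j => ?_).trans (h3.tsum_eq.trans ?_)
    · rw [show n + 2 + j = n + j + 2 by ring, show n + 1 + j = n + j + 1 by ring, hermiteH]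
      push_cast
      ring
    · simp only [add_assoc, add_comm 1] at ih0 ih1 ⊢
      rw [ih0, ih1, hermiteH]
      ring
end

section
/- Let α, x, t ∈ ℝ with t ≠ -1, and assume that for every m ≥ 0 the series ∑_{j≥0} (t^j/j!)·λ_{m+j}(x,α) converges absolutely. Then for every n ≥ 0: (1+t)^n · ∑_{j≥0} (t^j/j!)·λ_{n+j}(x,α) = λ_n(x/(1+t), α) · ∑_{j≥0} (t^j/j!)·λ_j(x,α). -/
/-- The monic Laguerre polynomials `λ_n(x,α) = (-1)^n n! L_n^{(α)}(x)`. -/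
noncomputable def laguerreM (α x : ℝ) : ℕ → ℝ
  | 0 => 1
  | 1 => x - (α + 1)
  | n + 2 => (x - (2 * (n + 1) + 1 + α)) * laguerreM α x (n + 1)
      - (n + 1) * ((n + 1) + α) * laguerreM α x n

theorem hasSum_index_mul_exp_coeff {t s : ℝ} {f : ℕ → ℝ}
    (h : HasSum (fun j : ℕ => t ^ j / (Nat.factorial j) * f (j + 1)) s) :
    HasSum (fun j : ℕ => t ^ j / (Nat.factorial j) * (j * f j)) (t * s) := by
  rw [← hasSum_nat_add_iff' 1]
  simp only [Finset.sum_range_one, Nat.cast_zero, zero_mul, mul_zero, sub_zero]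
  refine (h.mul_left t).congr_fun ?_
  intro j
  have hj : ((j : ℝ) + 1) ≠ 0 := by positivity
  have hf : ((Nat.factorial j : ℕ) : ℝ) ≠ 0 := by positivity
  rw [Nat.factorial_succ]
  push_cast
  field_simp
  ring

theorem hasSum_index_mul_pred_exp_coeff {t s : ℝ} {f : ℕ → ℝ}
    (h : HasSum (fun j : ℕ => t ^ j / (Nat.factorial j) * f (j + 2)) s) :
    HasSum (fun j : ℕ => t ^ j / (Nat.factorial j) * (j * ((j - 1) * f j))) (t * (t * s)) := by
  refine hasSum_index_mul_exp_coeff (f := fun j => ((j : ℝ) - 1) * f j) ?_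
  simpa using hasSum_index_mul_exp_coeff (f := fun j => f (j + 1)) h

theorem laguerreM_add_two (α x : ℝ) (n : ℕ) :
    laguerreM α x (n + 2) = (x - (2 * (n + 1) + 1 + α)) * laguerreM α x (n + 1)
      - (n + 1) * ((n + 1) + α) * laguerreM α x n := by
  rw [laguerreM]

/-- The three-term recurrence in a form that also covers `n = 0`, where the last term vanishes. -/
theorem laguerreM_succ (α x : ℝ) (n : ℕ) :
    laguerreM α x (n + 1) = (x - (2 * n + 1 + α)) * laguerreM α x n
      - n * (n + α) * laguerreM α x (n - 1) := by
  cases n with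
  | zero => simp [laguerreM]; ring
  | succ n => rw [laguerreM_add_two]; push_cast; simp

theorem laguerre_shifted_sum_one {α x t : ℝ} {S : ℕ → ℝ}
    (hS : ∀ n, HasSum (fun j : ℕ => t ^ j / (Nat.factorial j) * laguerreM α x (n + j)) (S n)) :
    (1 + t) ^ 2 * S 1 = (x - (1 + α) * (1 + t)) * S 0 := by
  have h1 := hasSum_index_mul_exp_coeff (t := t) (s := S 1) (f := laguerreM α x)
    (by simpa only [add_comm] using hS 1)
  have h2 := hasSum_index_mul_exp_coeff (t := t) (s := S 0) (f := fun j => laguerreM α x (j - 1))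
    (by simpa using hS 0)
  have h3 := hasSum_index_mul_pred_exp_coeff (t := t) (s := S 1)
    (f := fun j => laguerreM α x (j - 1)) (by simpa [add_comm] using hS 1)
  have h := (((hS 0).mul_left (x - (1 + α))).sub (h1.mul_left 2)).sub
    ((h2.mul_left (1 + α)).add h3)
  have key := (hS 1).unique (h.congr_fun fun j => by
    rw [add_comm 1 j, laguerreM_succ, zero_add]
    ring)
  linear_combination key

theorem laguerre_shifted_sum_add_two {α x t : ℝ} {S : ℕ → ℝ}
    (hS : ∀ n, HasSum (fun j : ℕ => t ^ j / (Nat.factorial j) * laguerreM α x (n + j)) (S n))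
    (n : ℕ) :
    (1 + t) ^ 2 * S (n + 2) = (x - (2 * (n + 1) + 1 + α) * (1 + t)) * S (n + 1)
      - (n + 1) * ((n + 1) + α) * S n := by
  have h1 := hasSum_index_mul_exp_coeff (t := t) (s := S (n + 2))
    (f := fun j => laguerreM α x (n + 1 + j))
    ((hS (n + 2)).congr_fun fun j => by congr 2; ring)
  have h2 := hasSum_index_mul_exp_coeff (t := t) (s := S (n + 1))
    (f := fun j => laguerreM α x (n + j))
    ((hS (n + 1)).congr_fun fun j => by congr 2; ring)
  have h3 := hasSum_index_mul_pred_exp_coeff (t := t) (s := S (n + 2))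
    (f := fun j => laguerreM α x (n + j))
    ((hS (n + 2)).congr_fun fun j => by congr 2; ring)
  have h := (((hS (n + 1)).mul_left (x - (2 * (n + 1) + 1 + α))).sub (h1.mul_left 2)).sub
    (((hS n).mul_left ((n + 1) * (n + 1 + α))).add ((h2.mul_left (2 * (n + 1) + 1 + α)).add h3))
  have key := (hS (n + 2)).unique (h.congr_fun fun j => by
    rw [show n + 2 + j = n + j + 2 by ring, laguerreM_add_two,
      show n + 1 + j = n + j + 1 by ring]
    push_cast
    ring)
  linear_combination key

theorem laguerre_shifted_generating_function (α x t : ℝ) (ht : t ≠ -1)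
    (hsum : ∀ m : ℕ, Summable fun j : ℕ => |t ^ j / (Nat.factorial j) * laguerreM α x (m + j)|) :
    ∀ n : ℕ,
      (1 + t) ^ n * ∑' j : ℕ, t ^ j / (Nat.factorial j) * laguerreM α x (n + j) =
        laguerreM α (x / (1 + t)) n * ∑' j : ℕ, t ^ j / (Nat.factorial j) * laguerreM α x j := by
  have ht' : 1 + t ≠ 0 := fun h => ht (by linarith)
  obtain ⟨S, hS⟩ : ∃ S : ℕ → ℝ, ∀ n,
      HasSum (fun j : ℕ => t ^ j / (Nat.factorial j) * laguerreM α x (n + j)) (S n) :=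
    ⟨_, fun n => (hsum n).of_abs.hasSum⟩
  have h0 : ∑' j : ℕ, t ^ j / (Nat.factorial j) * laguerreM α x j = S 0 := by
    simpa using (hS 0).tsum_eq
  intro n
  rw [(hS n).tsum_eq, h0]
  induction n using Nat.twoStepInduction with
  | zero => simp [laguerreM]
  | one =>
    have h := laguerre_shifted_sum_one hS
    simp only [laguerreM]
    field_simp
    linear_combination h
  | more n ih ih' =>
    have h := laguerre_shifted_sum_add_two hS n
    have hx : x = x / (1 + t) * (1 + t) := by field_simp
    rw [laguerreM_add_two]
    linear_combination (1 + t) ^ n * h + (x / (1 + t) - (2 * (n + 1) + 1 + α)) * ih'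
      - (n + 1) * ((n + 1) + α) * ih + (1 + t) ^ n * S (n + 1) * hx
end

section
/- Let x, t ∈ ℝ with |x| ≤ 1 and |t| < 1, and assume that for every m ≥ 0 the series ∑_{j≥0} t^j·U_{m+j}(x) converges absolutely. Then for every n ≥ 0: ∑_{j≥0} t^j·U_{n+j}(x) = (U_n(x) - t·U_{n-1}(x)) · ∑_{j≥0} t^j·U_j(x). -/
theorem chebU_add_two (x : ℝ) (n : ℤ) :
    chebU x (n + 2) = 2 * x * chebU x (n + 1) - chebU x n := by
  simp [chebU, Polynomial.Chebyshev.U_add_two]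

@[simp] theorem chebU_zero (x : ℝ) : chebU x 0 = 1 := by simp [chebU]

@[simp] theorem chebU_one (x : ℝ) : chebU x 1 = 2 * x := by simp [chebU]

@[simp] theorem chebU_neg_one (x : ℝ) : chebU x (-1) = 0 := by simp [chebU]

theorem chebU_add_natCast (x : ℝ) (n : ℤ) (j : ℕ) :
    chebU x (n + j) = chebU x n * chebU x j - chebU x (n - 1) * chebU x ((j : ℤ) - 1) := by
  induction j using Nat.twoStepInduction with
  | zero => simp
  | one =>
    have h := chebU_add_two x (n - 1)
    rw [show n - 1 + 2 = n + 1 by ring, sub_add_cancel] at h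
    simp [h]
    ring
  | more j h₀ h₁ =>
    have h₂ := chebU_add_two x (n + j)
    have h₃ := chebU_add_two x j
    have h₄ := chebU_add_two x ((j : ℤ) - 1)
    rw [show (j : ℤ) - 1 + 2 = j + 1 by ring, sub_add_cancel] at h₄
    push_cast at h₁ ⊢
    rw [← add_assoc, add_sub_cancel_right] at h₁
    rw [← add_assoc, show (j : ℤ) + 2 - 1 = j + 1 by ring, h₂, h₃, h₀, h₁, h₄]
    ring

theorem chebyshevU_shifted_generating_function (x t : ℝ) (hx : |x| ≤ 1) (ht : |t| < 1)
    (hsum : ∀ m : ℕ, Summable fun j : ℕ => |t ^ j * chebU x (m + j)|) :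
    ∀ n : ℕ,
      (∑' j : ℕ, t ^ j * chebU x (n + j)) =
        (chebU x n - t * chebU x ((n : ℤ) - 1)) * ∑' j : ℕ, t ^ j * chebU x j := by
  have hs : Summable fun j : ℕ => t ^ j * chebU x j := by simpa using (hsum 0).of_abs
  intro n
  have hshift : HasSum (fun j : ℕ => t ^ j * chebU x ((j : ℤ) - 1))
      (t * ∑' j : ℕ, t ^ j * chebU x j) := by
    rw [← hasSum_nat_add_iff' 1]
    simpa [pow_succ', mul_assoc] using hs.hasSum.mul_left t
  have h := (hs.hasSum.mul_left (chebU x n)).sub (hshift.mul_left (chebU x ((n : ℤ) - 1)))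
  rw [tsum_congr fun j : ℕ => show t ^ j * chebU x (n + j) =
      chebU x n * (t ^ j * chebU x j) -
        chebU x ((n : ℤ) - 1) * (t ^ j * chebU x ((j : ℤ) - 1)) by
    rw [chebU_add_natCast]; ring, h.tsum_eq]
  ring
end

section
/- For every a, b, x ∈ ℝ and every n ≥ 1: Q_n(x|a,b,0) = U_n(x) - (a+b)·U_{n-1}(x) + ab·U_{n-2}(x). -/
open scoped BigOperators

theorem chebU_eq (x : ℝ) (n : ℤ) : chebU x n = 2 * x * chebU x (n - 1) - chebU x (n - 2) := by
  simp [chebU, Polynomial.Chebyshev.U_eq ℝ n]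

theorem alSalamChihara_at_q_zero (a b x : ℝ) :
    ∀ n : ℕ, 1 ≤ n →
      alSalamChihara a b 0 x n =
        chebU x n - (a + b) * chebU x ((n : ℤ) - 1) + a * b * chebU x ((n : ℤ) - 2) := by
  intro n hn
  induction n using Nat.strong_induction_on with
  | _ n ih =>
    match n, hn with
    | 1, _ => simp [alSalamChihara, chebU]
    | 2, _ =>
      simp [alSalamChihara, chebU, Polynomial.Chebyshev.U_two]
      ring
    | k + 3, _ =>
      have h₂ := ih (k + 2) (by omega) (by omega)
      have h₁ := ih (k + 1) (by omega) (by omega)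
      have e₀ := chebU_eq x (k + 3)
      have e₁ := chebU_eq x (k + 2)
      have e₂ := chebU_eq x (k + 1)
      rw [alSalamChihara, h₂, h₁]
      push_cast
      ring_nf at e₀ e₁ e₂ ⊢
      rw [e₀, e₁, e₂]
      ring
end

section
/- Let -1 < q < 1, let ρ ∈ ℝ with |ρ| < 1, and let ξ : ℕ → ℝ be a sequence such that for every n ≥ 0 the series ∑_{i≥0} (ρ^i/(q)_i)·ξ_{n+i} converges absolutely. For r ∈ ℝ with |r| ≤ |ρ| put σ_n(r) = ∑_{i≥0} (r^i/(q)_i)·ξ_{n+i}. Then for all m, n ≥ 0: σ_n(ρ q^m) = ∑_{k=0}^{m} (-1)^k · [m choose k]_q · q^{k(k-1)/2} · ρ^k · σ_{n+k}(ρ). -/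
open scoped BigOperators

/-- The q-binomial coefficient `[m choose k]_q = (q)_m / ((q)_{m-k} (q)_k)`. -/
noncomputable def qBinom (q : ℝ) (m k : ℕ) : ℝ := qPoch q q m / (qPoch q q (m - k) * qPoch q q k)

theorem qBinom_zero_right {q : ℝ} (hq : -1 < q) (hq1 : q < 1) (m : ℕ) : qBinom q m 0 = 1 := by
  have h := qPoch_self_ne_zero hq hq1 m
  have h0 : qPoch q q 0 = 1 := Finset.prod_range_zero _
  rw [qBinom, Nat.sub_zero, h0, mul_one, div_self h]

theorem qBinom_self {q : ℝ} (hq : -1 < q) (hq1 : q < 1) (m : ℕ) : qBinom q m m = 1 := by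
  have h := qPoch_self_ne_zero hq hq1 m
  have h0 : qPoch q q 0 = 1 := Finset.prod_range_zero _
  rw [qBinom, Nat.sub_self, h0, one_mul, div_self h]

/-- The q-Pascal rule. -/
theorem qBinom_succ_succ {q : ℝ} (hq : -1 < q) (hq1 : q < 1) {m k : ℕ} (hk : k < m) :
    qBinom q (m + 1) (k + 1) = qBinom q m (k + 1) + q ^ (m - k) * qBinom q m k := by
  obtain ⟨d, rfl⟩ := Nat.exists_eq_add_of_lt hk
  have e1 : k + d + 1 + 1 - (k + 1) = d + 1 := by omega
  have e2 : k + d + 1 - (k + 1) = d := by omega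
  have e3 : k + d + 1 - k = d + 1 := by omega
  have hd := qPoch_self_ne_zero hq hq1 d
  have hk0 := qPoch_self_ne_zero hq hq1 k
  have hd1 := one_sub_pow_succ_ne_zero hq hq1 d
  have hk1 := one_sub_pow_succ_ne_zero hq hq1 k
  simp only [qBinom, e1, e2, e3]
  rw [qPoch_succ q q (k + d + 1), qPoch_succ q q d, qPoch_succ q q k]
  simp only [← pow_succ']
  field_simp
  ring

theorem choose_two_succ (k : ℕ) : (k + 1) * (k + 1 - 1) / 2 = k * (k - 1) / 2 + k := by
  rw [← Nat.choose_two_right, ← Nat.choose_two_right, Nat.choose_succ_succ' k 1,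
    Nat.choose_one_right, add_comm]

/-- A sequence family satisfying `f (m + 1) n = f m n - ρ q^m f m (n + 1)` is determined by `f 0`
through the alternating q-binomial expansion. -/
theorem eq_sum_qBinom_of_recursion {q : ℝ} (hq : -1 < q) (hq1 : q < 1) (ρ : ℝ) (f : ℕ → ℕ → ℝ)
    (hf : ∀ m n, f (m + 1) n = f m n - ρ * q ^ m * f m (n + 1)) (m n : ℕ) :
    f m n = ∑ k ∈ Finset.range (m + 1),
      (-1) ^ k * qBinom q m k * q ^ (k * (k - 1) / 2) * ρ ^ k * f 0 (n + k) := by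
  induction m generalizing n with
  | zero => simp [qBinom_self hq hq1]
  | succ m ih =>
    rw [hf, ih n, ih (n + 1), Finset.sum_range_succ' _ (m + 1), Finset.sum_range_succ' _ m,
      Finset.sum_range_succ _ m, Finset.sum_range_succ _ m]
    simp only [qBinom_zero_right hq hq1, qBinom_self hq hq1]
    have key : ∑ k ∈ Finset.range m, (-1) ^ (k + 1) * qBinom q (m + 1) (k + 1) *
          q ^ ((k + 1) * (k + 1 - 1) / 2) * ρ ^ (k + 1) * f 0 (n + (k + 1)) =
        ∑ k ∈ Finset.range m, (-1) ^ (k + 1) * qBinom q m (k + 1) *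
          q ^ ((k + 1) * (k + 1 - 1) / 2) * ρ ^ (k + 1) * f 0 (n + (k + 1)) -
        ρ * q ^ m * ∑ k ∈ Finset.range m, (-1) ^ k * qBinom q m k *
          q ^ (k * (k - 1) / 2) * ρ ^ k * f 0 (n + 1 + k) := by
      rw [Finset.mul_sum, ← Finset.sum_sub_distrib]
      refine Finset.sum_congr rfl fun k hk => ?_
      have hkm := Finset.mem_range.1 hk
      have hpow : q ^ m = q ^ (m - k) * q ^ k := by rw [← pow_add, Nat.sub_add_cancel hkm.le]
      rw [qBinom_succ_succ hq hq1 hkm, choose_two_succ, hpow, show n + 1 + k = n + (k + 1) by omega,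
        pow_add q]
      ring
    rw [key, choose_two_succ m, show n + 1 + m = n + (m + 1) by omega, pow_add q]
    ring

/-- The generating series `∑ r^i / (q)_i ξ_{n+i}` satisfies a first-order q-difference equation. -/
theorem tsum_q_shift {q : ℝ} (hq : -1 < q) (hq1 : q < 1) {r : ℝ} {ξ : ℕ → ℝ} {n : ℕ}
    (h0 : Summable fun i : ℕ => r ^ i / qPoch q q i * ξ (n + i))
    (h1 : Summable fun i : ℕ => r ^ i / qPoch q q i * ξ (n + 1 + i)) :
    ∑' i : ℕ, (r * q) ^ i / qPoch q q i * ξ (n + i) =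
      ∑' i : ℕ, r ^ i / qPoch q q i * ξ (n + i) -
        r * ∑' i : ℕ, r ^ i / qPoch q q i * ξ (n + 1 + i) := by
  have hs : HasSum (fun i : ℕ => r ^ i / qPoch q q i * (1 - q ^ i) * ξ (n + i))
      (r * ∑' i : ℕ, r ^ i / qPoch q q i * ξ (n + 1 + i)) := by
    rw [← hasSum_nat_add_iff' 1]
    have hz : ∑ i ∈ Finset.range 1, r ^ i / qPoch q q i * (1 - q ^ i) * ξ (n + i) = 0 := by
      simp
    have hterm (i : ℕ) : r ^ (i + 1) / qPoch q q (i + 1) * (1 - q ^ (i + 1)) * ξ (n + (i + 1)) =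
        r * (r ^ i / qPoch q q i * ξ (n + 1 + i)) := by
      have hi := qPoch_self_ne_zero hq hq1 i
      have hi1 := one_sub_pow_succ_ne_zero hq hq1 i
      rw [qPoch_succ, ← pow_succ', show n + 1 + i = n + (i + 1) by omega]
      field_simp
      ring
    simp only [hz, sub_zero, hterm]
    exact h1.hasSum.mul_left r
  have hterm (i : ℕ) : (r * q) ^ i / qPoch q q i * ξ (n + i) =
      r ^ i / qPoch q q i * ξ (n + i) - r ^ i / qPoch q q i * (1 - q ^ i) * ξ (n + i) := by
    rw [mul_pow]
    ring
  simp only [hterm]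
  exact (h0.hasSum.sub hs).tsum_eq

theorem sigma_q_power_expansion (q ρ : ℝ) (hq : -1 < q) (hq1 : q < 1) (hρ : |ρ| < 1)
    (ξ : ℕ → ℝ)
    (hsum : ∀ n : ℕ, Summable fun i : ℕ => |ρ ^ i / qPoch q q i * ξ (n + i)|)
    (σ : ℝ → ℕ → ℝ)
    (hσ : ∀ r : ℝ, |r| ≤ |ρ| → ∀ n : ℕ, σ r n = ∑' i : ℕ, r ^ i / qPoch q q i * ξ (n + i)) :
    ∀ m n : ℕ,
      σ (ρ * q ^ m) n =
        ∑ k ∈ Finset.range (m + 1),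
          (-1) ^ k * qBinom q m k * q ^ (k * (k - 1) / 2) * ρ ^ k * σ ρ (n + k) := by
  have hle (m : ℕ) : |ρ * q ^ m| ≤ |ρ| := by
    rw [abs_mul, abs_pow]
    exact mul_le_of_le_one_right (abs_nonneg ρ)
      (pow_le_one₀ (abs_nonneg q) (abs_lt.2 ⟨hq, hq1⟩).le)
  have hsummable (m n : ℕ) :
      Summable fun i : ℕ => (ρ * q ^ m) ^ i / qPoch q q i * ξ (n + i) := by
    refine Summable.of_norm_bounded (hsum n) fun i => ?_
    have hpow : |(ρ * q ^ m) ^ i| ≤ |ρ ^ i| := by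
      rw [abs_pow, abs_pow]
      exact pow_le_pow_left₀ (abs_nonneg _) (hle m) i
    rw [Real.norm_eq_abs, abs_mul, abs_div, abs_mul (ρ ^ i / _), abs_div (ρ ^ i)]
    gcongr
  intro m n
  have h := eq_sum_qBinom_of_recursion hq hq1 ρ (fun m n => σ (ρ * q ^ m) n) (fun m n => ?_) m n
  · simpa only [pow_zero, mul_one] using h
  · rw [hσ _ (hle _), hσ _ (hle _), hσ _ (hle _), pow_succ, ← mul_assoc]
    exact tsum_q_shift hq hq1 (hsummable m n) (hsummable m (n + 1))
end
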